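/- If L is the line graph obtained by WTA's linearization of a random spanning tree T of a labeled weighted graph (G,y), then E[Φ_L(y)] = O( Φ*_G(y) ), where Φ*_G(y) = min over labelings y'∈{−1,+1}^n of ( E[Φ_T(y')] + δ(y,y') ) and the expectations are over the random draw of the spanning tree T. -/

import Mathlib

open Classical

noncomputable section

variable {V : Type} [Fintype V] [DecidableEq V]

/-- The predicate on unordered edges saying the two endpoints have different labels
(a φ-edge). -/
def phiPred (y : V → Bool) : Sym2 V → Prop :=
  Sym2.lift ⟨fun i j => y i ≠ y j, fun _ _ => propext ne_comm⟩

/-- The set of φ-edges of a labeled graph. -/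
def phiEdges (G : SimpleGraph V) (y : V → Bool) : Set (Sym2 V) :=
  {e ∈ G.edgeSet | phiPred y e}

/-- The cutsize `Φ_G(y)`: number of φ-edges. -/
def cutN (G : SimpleGraph V) (y : V → Bool) : ℕ := (phiEdges G y).ncard

/-- The weighted cutsize `Φ^W_G(y)`. -/
def cutW (G : SimpleGraph V) (w : Sym2 V → ℝ) (y : V → Bool) : ℝ :=
  ∑ᶠ e ∈ phiEdges G y, w e

/-- The weight of a spanning tree: product of its edge weights. -/
def treeWeight (w : Sym2 V → ℝ) (T : SimpleGraph V) : ℝ :=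
  ∏ᶠ e ∈ T.edgeSet, w e

/-- `T` is a spanning tree of `G`. -/
def IsSpanningTree (G T : SimpleGraph V) : Prop := T ≤ G ∧ T.IsTree

/-- Expectation, over a random spanning tree of `G` drawn with probability proportional to
the product of its edge weights, of a function `f` of the tree. -/
def rstExp (G : SimpleGraph V) (w : Sym2 V → ℝ) (f : SimpleGraph V → ℝ) : ℝ :=
  (∑ᶠ T ∈ {T : SimpleGraph V | IsSpanningTree G T}, treeWeight w T * f T) /
    ∑ᶠ T ∈ {T : SimpleGraph V | IsSpanningTree G T}, treeWeight w T

/-- `R^W_T(¬E')`: sum of resistors of φ-free edges outside `E'`. -/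
def resistorSum (T : SimpleGraph V) (w : Sym2 V → ℝ) (y : V → Bool) (E' : Set (Sym2 V)) : ℝ :=
  ∑ᶠ e ∈ T.edgeSet \ (phiEdges T y ∪ E'), 1 / w e

/-- Effective conductance between `i` and `j` (Dirichlet principle). -/
def effCond (w : Sym2 V → ℝ) (i j : V) : ℝ :=
  sInf {x | ∃ φ : V → ℝ, φ i = 1 ∧ φ j = 0 ∧
    x = (1 / 2) * ∑ u : V, ∑ v : V, w s(u, v) * (φ u - φ v) ^ 2}

/-- Effective resistance between `i` and `j`. -/
def effRes (w : Sym2 V → ℝ) (i j : V) : ℝ := 1 / effCond w i j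

/-- Resistance distance between nodes `i` and `j` of a weighted line graph whose `k`-th edge
joins nodes `k` and `k+1` and has weight `wl k`. -/
def lineDist (wl : ℕ → ℝ) (i j : ℕ) : ℝ :=
  ∑ k ∈ Finset.Ico (min i j) (max i j), 1 / wl k

/-- φ-edges of a weighted line graph with `n` nodes `0, …, n-1`. -/
def linePhiSet (n : ℕ) (yl : ℕ → Bool) : Finset ℕ :=
  (Finset.range (n - 1)).filter (fun k => yl k ≠ yl (k + 1))

/-- Cutsize of a labeled line graph. -/
def linePhi (n : ℕ) (yl : ℕ → Bool) : ℕ := (linePhiSet n yl).card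

/-- Weighted cutsize of a labeled weighted line graph. -/
def linePhiW (n : ℕ) (wl : ℕ → ℝ) (yl : ℕ → Bool) : ℝ :=
  ∑ k ∈ linePhiSet n yl, wl k

/-- A run of the nearest-neighbor rule (the prediction phase of WTA) on a weighted line
graph with `n` nodes, weights `wl` and labels `yl`: an adversarial presentation order `σ`
together with predictions `pred`, where each prediction (after the first) is the label of a
closest previously revealed node in resistance distance. -/
structure NNRun (n : ℕ) (wl : ℕ → ℝ) (yl : ℕ → Bool) where
  σ : Fin n → Fin n
  bij : Function.Bijective σ
  pred : Fin n → Bool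
  nn : ∀ t : Fin n, 0 < (t : ℕ) →
    ∃ s : Fin n, (s : ℕ) < (t : ℕ) ∧
      (∀ s' : Fin n, (s' : ℕ) < (t : ℕ) →
        lineDist wl (σ s : ℕ) (σ t : ℕ) ≤ lineDist wl (σ s' : ℕ) (σ t : ℕ)) ∧
      pred t = yl (σ s : ℕ)

/-- Number of prediction mistakes of a nearest-neighbor run. -/
def NNRun.mistakes {n : ℕ} {wl : ℕ → ℝ} {yl : ℕ → Bool} (r : NNRun n wl yl) : ℕ :=
  (Finset.univ.filter (fun t : Fin n => r.pred t ≠ yl (r.σ t : ℕ))).card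

/-- Position of the first occurrence of `v` in the walk. -/
def firstOcc (walk : ℕ → V) (v : V) : ℕ := sInf {t | walk t = v}

/-- WTA's linearization of a tree `T` with `n` nodes: a depth-first visit of `T` is a closed
walk traversing each edge of `T` exactly twice; it produces the line graph with duplicates
`L'` (nodes `walk 0, …, walk (2(n-1))`, the `t`-th edge having weight `w s(walk t, walk (t+1))`).
Duplicate elimination yields the line graph `L` whose nodes are the nodes of `T` in order of
first visit (`ord`), consecutive nodes being joined by an edge whose weight is the minimum
weight among the eliminated edges of `L'` between them. -/
structure Linearization (T : SimpleGraph V) (n : ℕ) where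
  walk : ℕ → V
  adj : ∀ t < 2 * (n - 1), T.Adj (walk t) (walk (t + 1))
  closed : walk (2 * (n - 1)) = walk 0
  twice : ∀ e ∈ T.edgeSet,
    ((Finset.range (2 * (n - 1))).filter (fun t => s(walk t, walk (t + 1)) = e)).card = 2
  ord : ℕ → V
  ord_inj : ∀ k < n, ∀ k' < n, ord k = ord k' → k = k'
  ord_surj : ∀ v : V, ∃ k < n, ord k = v
  ord_mono : ∀ k k', k < k' → k' < n → firstOcc walk (ord k) < firstOcc walk (ord k')

/-- Edge weights of the line graph `L` produced by the linearization: the `k`-th edge of `L`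
joins the `k`-th and `(k+1)`-th nodes in order of first visit, and its weight is the minimum
of the weights of the edges of `L'` lying between the first occurrences of these two nodes
(the iterated duplicate-elimination rule `w_{j',j''} = min {w_{j',j}, w_{j,j''}}`). -/
def Linearization.wl {T : SimpleGraph V} {n : ℕ} (L : Linearization T n)
    (w : Sym2 V → ℝ) (k : ℕ) : ℝ :=
  sInf ((fun t => w s(L.walk t, L.walk (t + 1))) ''
    Set.Ico (firstOcc L.walk (L.ord k)) (firstOcc L.walk (L.ord (k + 1))))

/-- Labels of the line graph `L`: each node of `L` inherits the label of the corresponding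
node of `T`. -/
def Linearization.yl {T : SimpleGraph V} {n : ℕ} (L : Linearization T n)
    (y : V → Bool) (k : ℕ) : Bool := y (L.ord k)

/-- `ζ_T(K)`: the total weight of the `K` heaviest edges of `T`. -/
def zeta (T : SimpleGraph V) (w : Sym2 V → ℝ) (K : ℕ) : ℝ :=
  sSup {x | ∃ E' ⊆ T.edgeSet, E'.ncard = K ∧ x = ∑ᶠ e ∈ E', w e}

/-- `δ(y,y')`: number of nodes where the two labelings differ. -/
def hamming (y y' : V → Bool) : ℕ := {i | y i ≠ y' i}.ncard


/-- `Φ̃^W_T(y)`: robust weighted cutsize (minimum over perturbed labelings). -/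
def robustCutW (T : SimpleGraph V) (w : Sym2 V → ℝ) (y : V → Bool) : ℝ :=
  sInf {x | ∃ y' : V → Bool, x = 2 * (cutW T w y' + zeta T w (hamming y y'))}

/-- `Φ̃_T(y)`: robust cutsize (minimum over perturbed labelings). -/
def robustCutN (T : SimpleGraph V) (y : V → Bool) : ℝ :=
  sInf {x | ∃ y' : V → Bool, x = 2 * ((cutN T y' : ℝ) + (hamming y y' : ℝ))}

/-- `Φ*_G(y)`: robust expected cutsize of a random spanning tree of `G`. -/
def robustCutRST (G : SimpleGraph V) (w : Sym2 V → ℝ) (y : V → Bool) : ℝ :=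
  sInf {x | ∃ y' : V → Bool,
    x = rstExp G w (fun T => (cutN T y' : ℝ)) + (hamming y y' : ℝ)}

/-- Cutsize of the line graph with duplicates `L'`. -/
def Linearization.phi' {T : SimpleGraph V} {n : ℕ} (L : Linearization T n)
    (y : V → Bool) : ℕ :=
  ((Finset.range (2 * (n - 1))).filter (fun t => y (L.walk t) ≠ y (L.walk (t + 1)))).card

/-- Weighted cutsize of the line graph with duplicates `L'`. -/
def Linearization.phiW' {T : SimpleGraph V} {n : ℕ} (L : Linearization T n)
    (w : Sym2 V → ℝ) (y : V → Bool) : ℝ :=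
  ∑ t ∈ (Finset.range (2 * (n - 1))).filter (fun t => y (L.walk t) ≠ y (L.walk (t + 1))),
    w s(L.walk t, L.walk (t + 1))

/-- `p_e`: the probability that edge `e` belongs to a random spanning tree of `G`. -/
def edgeProb (G : SimpleGraph V) (w : Sym2 V → ℝ) (e : Sym2 V) : ℝ :=
  rstExp G w (fun T => if e ∈ T.edgeSet then 1 else 0)

/-- `p_{i,j} = w_{i,j} · r^W_{i,j}`. -/
def pWeight (w : Sym2 V → ℝ) (i j : V) : ℝ := w s(i, j) * effRes w i j

/-- `P_i = Σ_j p_{i,j}`: the weight of node `i`. -/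
def nodeWeight (G : SimpleGraph V) (w : Sym2 V → ℝ) (i : V) : ℝ :=
  ∑ j : V, if G.Adj i j then pWeight w i j else 0

/-- The `p`-weighted cutsize `Φ^P_G(y)`. -/
def pCutW (G : SimpleGraph V) (w : Sym2 V → ℝ) (y : V → Bool) : ℝ :=
  (1 / 2) * ∑ u : V, ∑ v : V, if G.Adj u v ∧ y u ≠ y v then pWeight w u v else 0

/-- `P^int_S`: sum of `p_{i,j}` over edges with both endpoints in `S`. -/
def pIntS (G : SimpleGraph V) (w : Sym2 V → ℝ) (S : Finset V) : ℝ :=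
  (1 / 2) * ∑ i ∈ S, ∑ j ∈ S, if G.Adj i j then pWeight w i j else 0

/-- `P^ext_S`: sum of `p_{i,j}` over edges with exactly one endpoint in `S`. -/
def pExtS (G : SimpleGraph V) (w : Sym2 V → ℝ) (S : Finset V) : ℝ :=
  ∑ i ∈ S, ∑ j ∈ Sᶜ, if G.Adj i j then pWeight w i j else 0

end

section LineCutsize

variable {V : Type} [Fintype V] [DecidableEq V] {T : SimpleGraph V} {n : ℕ}

/-- If a Boolean sequence takes different values at `a` and `b`, it changes between them. -/
theorem exists_ne_succ_of_ne {f : ℕ → Bool} {a b : ℕ} (hab : a ≤ b) (h : f a ≠ f b) :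
    ∃ t, a ≤ t ∧ t < b ∧ f t ≠ f (t + 1) := by
  by_contra! hc
  refine h ?_
  induction b, hab using Nat.le_induction with
  | base => rfl
  | succ m hm ih =>
    by_cases hne : f a = f m
    · exact hne.trans (hc m hm (Nat.lt_succ_self m))
    · exact absurd (ih hne fun t h₁ h₂ => hc t h₁ (h₂.trans (Nat.lt_succ_self m))) hne

/-- In a depth-first visit of a tree with at least two nodes, every node occurs. -/
theorem Linearization.exists_walk_eq (hT : T.IsTree) (hn : n = Fintype.card V) (hn2 : 2 ≤ n)
    (L : Linearization T n) (v : V) : ∃ t ≤ 2 * (n - 1), L.walk t = v := by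
  have : Nontrivial V := Fintype.one_lt_card_iff_nontrivial.mp (by omega)
  obtain ⟨u, hu⟩ := hT.connected.preconnected.exists_adj_of_nontrivial v
  have htwice := L.twice s(v, u) hu
  obtain ⟨t, ht⟩ := Finset.card_pos.mp (htwice.symm ▸ two_pos)
  rw [Finset.mem_filter, Finset.mem_range, Sym2.eq_iff] at ht
  obtain ⟨hlt, ⟨h, -⟩ | ⟨-, h⟩⟩ := ht
  · exact ⟨t, hlt.le, h⟩
  · exact ⟨t + 1, hlt, h⟩

theorem Linearization.walk_firstOcc (hT : T.IsTree) (hn : n = Fintype.card V) (hn2 : 2 ≤ n)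
    (L : Linearization T n) (v : V) : L.walk (firstOcc L.walk v) = v := by
  obtain ⟨t, -, ht⟩ := L.exists_walk_eq hT hn hn2 v
  exact Nat.sInf_mem (s := {t | L.walk t = v}) ⟨t, ht⟩

theorem Linearization.firstOcc_le (hT : T.IsTree) (hn : n = Fintype.card V) (hn2 : 2 ≤ n)
    (L : Linearization T n) (v : V) : firstOcc L.walk v ≤ 2 * (n - 1) := by
  obtain ⟨t, hle, ht⟩ := L.exists_walk_eq hT hn hn2 v
  exact (Nat.sInf_le (s := {t | L.walk t = v}) ht).trans hle

/-- Eliminating duplicates does not increase the cutsize. -/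
theorem Linearization.linePhi_le_phi' (hT : T.IsTree) (hn : n = Fintype.card V)
    (L : Linearization T n) (y : V → Bool) : linePhi n (L.yl y) ≤ L.phi' y := by
  rcases lt_or_ge n 2 with hlt | hn2
  · have : n - 1 = 0 := by omega
    simp [linePhi, linePhiSet, this]
  have key : ∀ k ∈ linePhiSet n (L.yl y), ∃ t, firstOcc L.walk (L.ord k) ≤ t ∧
      t < firstOcc L.walk (L.ord (k + 1)) ∧ y (L.walk t) ≠ y (L.walk (t + 1)) := by
    intro k hk
    rw [linePhiSet, Finset.mem_filter, Finset.mem_range] at hk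
    refine exists_ne_succ_of_ne (f := fun t => y (L.walk t))
      (L.ord_mono k (k + 1) (Nat.lt_succ_self k) (by omega)).le ?_
    simpa only [L.walk_firstOcc hT hn hn2, Linearization.yl] using hk.2
  choose! g hg₁ hg₂ hg₃ using key
  have hlt : ∀ k ∈ linePhiSet n (L.yl y), ∀ k' ∈ linePhiSet n (L.yl y), k < k' → g k < g k' := by
    intro k hk k' hk' hkk'
    have hk'n : k' < n := by
      rw [linePhiSet, Finset.mem_filter, Finset.mem_range] at hk'
      omega
    refine (hg₂ k hk).trans_le (le_trans ?_ (hg₁ k' hk'))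
    rcases (Nat.succ_le_of_lt hkk').eq_or_lt with h | h
    · rw [← h]
    · exact (L.ord_mono _ _ h hk'n).le
  refine Finset.card_le_card_of_injOn g (fun k hk => ?_) fun k hk k' hk' h => ?_
  · rw [Finset.mem_coe, Finset.mem_filter, Finset.mem_range]
    exact ⟨(hg₂ k hk).trans_le (L.firstOcc_le hT hn hn2 _), hg₃ k hk⟩
  · rcases lt_trichotomy k k' with h' | h' | h'
    · exact absurd h (hlt k hk k' hk' h').ne
    · exact h'
    · exact absurd h (hlt k' hk' k hk h').ne'

/-- Each φ-edge of the tree is traversed twice by the visit. -/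
theorem Linearization.phi'_le (L : Linearization T n) (y : V → Bool) :
    L.phi' y ≤ 2 * cutN T y := by
  rw [cutN, Set.ncard_eq_toFinset_card', Linearization.phi']
  refine Finset.card_le_mul_card_image_of_maps_to
    (f := fun t => s(L.walk t, L.walk (t + 1))) (fun t ht => ?_) 2 fun e he => ?_
  · rw [Finset.mem_filter, Finset.mem_range] at ht
    exact Set.mem_toFinset.mpr ⟨L.adj t ht.1, ht.2⟩
  · exact (Finset.card_le_card (Finset.filter_subset_filter _ (Finset.filter_subset _ _))).trans
      (L.twice e (Set.mem_toFinset.mp he).1).le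

/-- Changing one label changes the cutsize of a line graph by at most two. -/
theorem Linearization.linePhi_le_add_hamming (L : Linearization T n) (y y' : V → Bool) :
    linePhi n (L.yl y) ≤ linePhi n (L.yl y') + 2 * hamming y y' := by
  have hcard : ∀ d ≤ 1, ((Finset.range (n - 1)).filter
      fun k => y (L.ord (k + d)) ≠ y' (L.ord (k + d))).card ≤ hamming y y' := by
    intro d hd
    rw [hamming, Set.ncard_eq_toFinset_card']
    refine Finset.card_le_card_of_injOn (fun k => L.ord (k + d)) (fun k hk => ?_)
      fun k hk k' hk' h => ?_
    · rw [Finset.mem_coe, Finset.mem_filter] at hk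
      exact Finset.mem_coe.mpr (Set.mem_toFinset.mpr hk.2)
    · rw [Finset.mem_coe, Finset.mem_filter, Finset.mem_range] at hk hk'
      have := L.ord_inj _ (by omega) _ (by omega) h
      omega
  have hsub : linePhiSet n (L.yl y) ⊆ linePhiSet n (L.yl y') ∪
      ((Finset.range (n - 1)).filter (fun k => y (L.ord (k + 0)) ≠ y' (L.ord (k + 0))) ∪
        (Finset.range (n - 1)).filter fun k => y (L.ord (k + 1)) ≠ y' (L.ord (k + 1))) := by
    intro k hk
    simp only [linePhiSet, Linearization.yl, Finset.mem_union, Finset.mem_filter,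
      Nat.add_zero] at hk ⊢
    grind
  have h₁ := (Finset.card_le_card hsub).trans (Finset.card_union_le _ _)
  have h₂ := h₁.trans (Nat.add_le_add_left (Finset.card_union_le _ _) _)
  have h₃ := hcard 0 zero_le_one
  have h₄ := hcard 1 le_rfl
  unfold linePhi
  omega

end LineCutsize

section Expectation

variable {V : Type} [Fintype V] {G : SimpleGraph V} {w : Sym2 V → ℝ}

theorem treeWeight_pos (hw : ∀ e ∈ G.edgeSet, 0 < w e) {T : SimpleGraph V} (hT : T ≤ G) :
    0 < treeWeight w T := by
  rw [treeWeight, finprod_mem_eq_toFinset_prod]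
  exact Finset.prod_pos fun e he =>
    hw e (SimpleGraph.edgeSet_mono hT (Set.mem_toFinset.mp he))

theorem rstExp_eq_finset_sum (f : SimpleGraph V → ℝ) :
    rstExp G w f =
      (∑ T ∈ {T : SimpleGraph V | IsSpanningTree G T}.toFinset, treeWeight w T * f T) /
        ∑ T ∈ {T : SimpleGraph V | IsSpanningTree G T}.toFinset, treeWeight w T := by
  rw [rstExp, finsum_mem_eq_toFinset_sum, finsum_mem_eq_toFinset_sum]

/-- Monotonicity of the expectation, for an upper bound that is an affine function of `g`. -/
theorem rstExp_le_mul_add (hG : G.Connected) (hw : ∀ e ∈ G.edgeSet, 0 < w e)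
    {f g : SimpleGraph V → ℝ} {a b : ℝ}
    (h : ∀ T, IsSpanningTree G T → f T ≤ a * g T + b) :
    rstExp G w f ≤ a * rstExp G w g + b := by
  rw [rstExp_eq_finset_sum, rstExp_eq_finset_sum]
  set S := {T : SimpleGraph V | IsSpanningTree G T}.toFinset with hS
  have hpos : 0 < ∑ T ∈ S, treeWeight w T := by
    obtain ⟨T, hT⟩ := hG.exists_isTree_le
    exact Finset.sum_pos (fun T hT => treeWeight_pos hw (Set.mem_toFinset.mp hT).1)
      ⟨T, Set.mem_toFinset.mpr hT⟩
  rw [div_le_iff₀ hpos, add_mul, mul_assoc, div_mul_cancel₀ _ hpos.ne', Finset.mul_sum,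
    Finset.mul_sum, ← Finset.sum_add_distrib]
  refine Finset.sum_le_sum fun T hT => ?_
  have hTS := Set.mem_toFinset.mp hT
  calc treeWeight w T * f T ≤ treeWeight w T * (a * g T + b) :=
        mul_le_mul_of_nonneg_left (h T hTS) (treeWeight_pos hw hTS.1).le
    _ = a * (treeWeight w T * g T) + b * treeWeight w T := by ring

end Expectation

/-- Lemma 7. If `L` is the line graph obtained by WTA's linearization of
a random spanning tree `T` of a labeled weighted graph `(G,y)`, then
`E[Φ_L(y)] = O( Φ*_G(y) )`, where `Φ*_G(y) = min_{y'} ( E[Φ_T(y')] + δ(y,y') )` and the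
expectations are over the random draw of the spanning tree. -/
theorem exp_line_cutsize_bound :
    ∃ c : ℝ, 0 < c ∧
      ∀ (V : Type) [Fintype V] [DecidableEq V] (G : SimpleGraph V),
        G.Connected →
        ∀ w : Sym2 V → ℝ, (∀ e ∈ G.edgeSet, 0 < w e) →
        ∀ (y : V → Bool) (n : ℕ), n = Fintype.card V →
        ∀ pL : SimpleGraph V → ℕ,
          (∀ T, IsSpanningTree G T →
            ∃ L : Linearization T n, pL T = linePhi n (L.yl y)) →
          rstExp G w (fun T => (pL T : ℝ)) ≤ c * robustCutRST G w y := by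
  refine ⟨2, two_pos, fun V _ _ G hG w hw y n hn pL hpL => ?_⟩
  rw [← div_le_iff₀' two_pos, robustCutRST]
  refine le_csInf ⟨_, y, rfl⟩ ?_
  rintro _ ⟨y', rfl⟩
  have h : rstExp G w (fun T => (pL T : ℝ)) ≤
      2 * rstExp G w (fun T => (cutN T y' : ℝ)) + 2 * (hamming y y' : ℝ) := by
    refine rstExp_le_mul_add hG hw fun T hT => ?_
    obtain ⟨L, hL⟩ := hpL T hT
    have h₁ := L.linePhi_le_add_hamming y y'
    have h₂ := (L.linePhi_le_phi' hT.2 hn y').trans (L.phi'_le y')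
    exact_mod_cast (by omega : pL T ≤ 2 * cutN T y' + 2 * hamming y y')
  linarith
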